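/- arXiv:2407.11423 — 3 statements merged into one kernel-verified Lean document; each statement's English description precedes it below -/
import Mathlib

section
/- Let d ≥ 1 be an integer and τ > 0, and define p(y) = (2^{d-2} π^{d+2})^{-1/2} · 𝒞(‖y‖²/2, τ²) for y ∈ ℝ^d. Then there exists a finite constant b_τ, depending only on d and τ, such that ‖∇_y log p(y)‖ ≤ b_τ for all y ∈ ℝ^d; equivalently, the difference between y and the posterior mean E(θ|y) = y + ∇_y log p(y) is bounded in Euclidean norm uniformly in y. -/
open MeasureTheory Real

/-- `𝒞(a,b) = ∫_0^∞ exp(-a/(1+λ²b)) (1+λ²b)^{-d/2} (1+λ²)^{-1} dλ`. -/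
noncomputable def Cfun (d : ℕ) (a b : ℝ) : ℝ :=
  ∫ l in Set.Ioi (0:ℝ),
    Real.exp (-a / (1 + l ^ 2 * b)) * (1 + l ^ 2 * b) ^ (-(d:ℝ)/2) * (1 + l ^ 2)⁻¹

/-- integrand -/
noncomputable def hsW (d : ℕ) (b l : ℝ) : ℝ :=
  (1 + l ^ 2 * b) ^ (-(d:ℝ)/2) * (1 + l ^ 2)⁻¹

lemma hs_s_ge {b : ℝ} (hb : 0 < b) (l : ℝ) : 1 ≤ 1 + l ^ 2 * b := by
  have := mul_nonneg (sq_nonneg l) hb.le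
  linarith

lemma hsW_pos (d : ℕ) {b : ℝ} (hb : 0 < b) (l : ℝ) : 0 < hsW d b l := by
  have := hs_s_ge hb l
  unfold hsW
  have h2 : 0 < 1 + l ^ 2 := by positivity
  have h3 : 0 < (1 + l ^ 2 * b) ^ (-(d:ℝ)/2) := Real.rpow_pos_of_pos (by linarith) _
  positivity

lemma hsW_le (d : ℕ) {b : ℝ} (hb : 0 < b) (l : ℝ) : hsW d b l ≤ (1 + l ^ 2)⁻¹ := by
  have := hs_s_ge hb l
  unfold hsW
  have h2 : 0 < 1 + l ^ 2 := by positivity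
  have h3 : (1 + l ^ 2 * b) ^ (-(d:ℝ)/2) ≤ 1 := by
    apply Real.rpow_le_one_of_one_le_of_nonpos this
    have : (0:ℝ) ≤ d := Nat.cast_nonneg d
    linarith
  exact mul_le_of_le_one_left (by positivity) h3

lemma hsW_cont (d : ℕ) {b : ℝ} (hb : 0 < b) : Continuous (hsW d b) := by
  unfold hsW
  apply Continuous.mul
  · apply Continuous.rpow_const (by fun_prop)
    intro l
    left
    have := hs_s_ge hb l
    linarith
  · apply Continuous.inv₀ (by fun_prop)
    intro l
    positivity

lemma hs_exp_cont {b : ℝ} (hb : 0 < b) (a : ℝ) :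
    Continuous (fun l : ℝ => Real.exp (-a / (1 + l ^ 2 * b))) := by
  apply Real.continuous_exp.comp
  apply Continuous.div (by fun_prop) (by fun_prop)
  intro l
  have := hs_s_ge hb l
  linarith

lemma hs_exp_le {b : ℝ} (hb : 0 < b) {a : ℝ} (ha : 0 ≤ a) (l : ℝ) :
    Real.exp (-a / (1 + l ^ 2 * b)) ≤ 1 := by
  have := hs_s_ge hb l
  rw [Real.exp_le_one_iff]
  apply div_nonpos_of_nonpos_of_nonneg <;> linarith

lemma hs_int0 : Integrable (fun l : ℝ => (1 + l ^ 2)⁻¹) (volume.restrict (Set.Ioi (0:ℝ))) :=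
  integrable_inv_one_add_sq.restrict

lemma hs_int (d : ℕ) {b : ℝ} (hb : 0 < b) {a : ℝ} (ha : 0 ≤ a) :
    Integrable (fun l : ℝ => Real.exp (-a / (1 + l ^ 2 * b)) * hsW d b l)
      (volume.restrict (Set.Ioi (0:ℝ))) := by
  apply hs_int0.mono' ((hs_exp_cont hb a).mul (hsW_cont d hb)).aestronglyMeasurable
  filter_upwards with l
  have h := hsW_pos d hb l
  change ‖Real.exp (-a / (1 + l ^ 2 * b)) * hsW d b l‖ ≤ _
  rw [Real.norm_of_nonneg (mul_pos (Real.exp_pos _) h).le]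
  exact (mul_le_of_le_one_left h.le (hs_exp_le hb ha l)).trans (hsW_le d hb l)

lemma Cfun_eq (d : ℕ) (a b : ℝ) :
    Cfun d a b = ∫ l in Set.Ioi (0:ℝ), Real.exp (-a / (1 + l ^ 2 * b)) * hsW d b l := by
  unfold Cfun hsW
  simp only [mul_assoc]

/-- negative of the derivative of `Cfun` in `a` -/
noncomputable def hsN (d : ℕ) (a b : ℝ) : ℝ :=
  ∫ l in Set.Ioi (0:ℝ), (1 + l ^ 2 * b)⁻¹ * Real.exp (-a / (1 + l ^ 2 * b)) * hsW d b l

lemma hsN_cont (d : ℕ) {b : ℝ} (hb : 0 < b) (a : ℝ) : Continuous (fun l : ℝ =>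
    (1 + l ^ 2 * b)⁻¹ * Real.exp (-a / (1 + l ^ 2 * b)) * hsW d b l) := by
  refine Continuous.mul (Continuous.mul (Continuous.inv₀ (by fun_prop) ?_) (hs_exp_cont hb a))
    (hsW_cont d hb)
  intro l
  have := hs_s_ge hb l
  linarith

lemma hsN_int (d : ℕ) {b : ℝ} (hb : 0 < b) {a : ℝ} (ha : 0 ≤ a) : Integrable (fun l : ℝ =>
    (1 + l ^ 2 * b)⁻¹ * Real.exp (-a / (1 + l ^ 2 * b)) * hsW d b l)
      (volume.restrict (Set.Ioi (0:ℝ))) := by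
  apply (hs_int d hb ha).mono' (hsN_cont d hb a).aestronglyMeasurable
  filter_upwards with l
  have h := hsW_pos d hb l
  have h1 := hs_s_ge hb l
  have h0 : (0:ℝ) < 1 + l ^ 2 * b := by linarith
  rw [Real.norm_of_nonneg (by positivity), mul_assoc]
  exact mul_le_of_le_one_left (by positivity) (inv_le_one_of_one_le₀ h1)

lemma hs_hasDeriv (d : ℕ) {b : ℝ} (hb : 0 < b) {a : ℝ} (ha : 0 ≤ a) :
    HasDerivAt (fun x => Cfun d x b) (-hsN d a b) a := by
  have key := hasDerivAt_integral_of_dominated_loc_of_deriv_le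
    (μ := volume.restrict (Set.Ioi (0:ℝ)))
    (F := fun x l => Real.exp (-x / (1 + l ^ 2 * b)) * hsW d b l)
    (F' := fun x l => -((1 + l ^ 2 * b)⁻¹ * Real.exp (-x / (1 + l ^ 2 * b)) * hsW d b l))
    (x₀ := a) (s := Metric.ball a 1) (bound := fun l => Real.exp 1 * (1 + l ^ 2)⁻¹)
    (Metric.ball_mem_nhds a one_pos)
    (Filter.Eventually.of_forall fun x =>
      ((hs_exp_cont hb x).mul (hsW_cont d hb)).aestronglyMeasurable)
    (hs_int d hb ha) (hsN_cont d hb a).neg.aestronglyMeasurable ?_ (hs_int0.const_mul _) ?_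
  · have h2 := key.2
    rw [integral_neg] at h2
    simpa only [Cfun_eq, hsN] using h2
  · filter_upwards with l x hx
    have h := hsW_pos d hb l
    have h1 := hs_s_ge hb l
    have h0 : (0:ℝ) < 1 + l ^ 2 * b := by linarith
    rw [norm_neg, Real.norm_of_nonneg (by positivity)]
    have hx' : -1 < x := by
      rw [Metric.mem_ball, Real.dist_eq, abs_lt] at hx
      linarith [hx.1]
    have he : Real.exp (-x / (1 + l ^ 2 * b)) ≤ Real.exp 1 := by
      apply Real.exp_le_exp.2
      rw [div_le_one h0]
      linarith
    have hi := inv_le_one_of_one_le₀ h1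
    apply mul_le_mul _ (hsW_le d hb l) h.le (by positivity)
    calc _ ≤ 1 * Real.exp 1 := mul_le_mul hi he (by positivity) (by positivity)
      _ = _ := one_mul _
  · filter_upwards with l x hx
    have h3 : HasDerivAt (fun x : ℝ => -x / (1 + l ^ 2 * b)) (-1 / (1 + l ^ 2 * b)) x :=
      (hasDerivAt_id x).neg.div_const _
    refine (h3.exp.mul_const (hsW d b l)).congr_deriv ?_
    ring

lemma hs_upper (d : ℕ) {b : ℝ} (hb : 0 < b) {r : ℝ} (hr : 0 ≤ r) :
    r * hsN d (r ^ 2 / 2) b ≤ Cfun d (r ^ 2 / 2) b +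
      r * Real.exp (-(r / 2)) * ∫ l in Set.Ioi (0:ℝ), (1 + l ^ 2)⁻¹ := by
  have ha : 0 ≤ r ^ 2 / 2 := by positivity
  rw [Cfun_eq, hsN, ← integral_const_mul, ← integral_const_mul,
    ← integral_add (hs_int d hb ha) (hs_int0.const_mul _)]
  apply integral_mono ((hsN_int d hb ha).const_mul _)
    ((hs_int d hb ha).add (hs_int0.const_mul _))
  intro l
  have h := hsW_pos d hb l
  have hle := hsW_le d hb l
  have h1 := hs_s_ge hb l
  simp only []
  set s := 1 + l ^ 2 * b
  have h0 : (0:ℝ) < s := by linarith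
  have hl : (0:ℝ) < (1 + l ^ 2)⁻¹ := by positivity
  rcases le_total r s with hrs | hrs
  · have : r * s⁻¹ ≤ 1 := by
      rw [← div_eq_mul_inv]; exact (div_le_one h0).2 hrs
    calc _ = (r * s⁻¹) * (Real.exp (-(r ^ 2 / 2) / s) * hsW d b l) := by ring
      _ ≤ Real.exp (-(r ^ 2 / 2) / s) * hsW d b l := mul_le_of_le_one_left (by positivity) this
      _ ≤ _ := le_add_of_nonneg_right (by positivity)
  · have he : Real.exp (-(r ^ 2 / 2) / s) ≤ Real.exp (-(r / 2)) := by
      apply Real.exp_le_exp.2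
      rw [div_le_iff₀ h0]
      nlinarith
    have hi := inv_le_one_of_one_le₀ h1
    calc _ = r * (s⁻¹ * Real.exp (-(r ^ 2 / 2) / s) * hsW d b l) := by ring
      _ ≤ r * (1 * Real.exp (-(r / 2)) * (1 + l ^ 2)⁻¹) := by gcongr
      _ = r * Real.exp (-(r / 2)) * (1 + l ^ 2)⁻¹ := by ring
      _ ≤ _ := le_add_of_nonneg_left (by positivity)

lemma hs_lower (d : ℕ) {b : ℝ} (hb : 0 < b) {r : ℝ} (hr : 0 ≤ r) :
    Real.exp (-(1 / (2 * b))) * ((((1 + b) * (r + 2) ^ 2) ^ d)⁻¹ * (2 * (r + 2) ^ 2)⁻¹) ≤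
      Cfun d (r ^ 2 / 2) b := by
  have ha : 0 ≤ r ^ 2 / 2 := by positivity
  set c := Real.exp (-(1 / (2 * b))) * ((((1 + b) * (r + 2) ^ 2) ^ d)⁻¹ * (2 * (r + 2) ^ 2)⁻¹)
    with hc
  rw [Cfun_eq]
  have hsub : Set.Ioc (r + 1) (r + 2) ⊆ Set.Ioi (0:ℝ) := by
    intro x hx
    have := hx.1
    simp only [Set.mem_Ioi]
    linarith
  have h1 : ∫ l in Set.Ioc (r + 1) (r + 2), c = c := by
    rw [setIntegral_const]
    simp
    norm_num
  calc c = ∫ l in Set.Ioc (r + 1) (r + 2), c := h1.symm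
    _ ≤ ∫ l in Set.Ioc (r + 1) (r + 2),
        Real.exp (-(r ^ 2 / 2) / (1 + l ^ 2 * b)) * hsW d b l := by
      apply setIntegral_mono_on
      · exact integrableOn_const (by simp)
      · exact IntegrableOn.mono_set (hs_int d hb ha) hsub
      · exact measurableSet_Ioc
      · intro l hl
        obtain ⟨hl1, hl2⟩ := hl
        have hs := hs_s_ge hb l
        have hl0 : 0 ≤ l := by linarith
        have hll : l ^ 2 ≤ (r + 2) ^ 2 := by gcongr
        have hrl : r ^ 2 ≤ l ^ 2 := by gcongr; linarith
        have h1r : 1 ≤ (r + 2) ^ 2 := by nlinarith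
        have hsu : 1 + l ^ 2 * b ≤ (1 + b) * (r + 2) ^ 2 := by nlinarith
        have h0 : 0 < 1 + l ^ 2 * b := by linarith
        rw [hc]
        have e1 : Real.exp (-(1 / (2 * b))) ≤ Real.exp (-(r ^ 2 / 2) / (1 + l ^ 2 * b)) := by
          apply Real.exp_le_exp.2
          rw [neg_div, neg_le_neg_iff, div_div, div_le_div_iff₀ (by positivity) (by positivity)]
          nlinarith
        have e2 : (((1 + b) * (r + 2) ^ 2) ^ d)⁻¹ ≤ (1 + l ^ 2 * b) ^ (-(d:ℝ)/2) := by
          calc (((1 + b) * (r + 2) ^ 2) ^ d)⁻¹ ≤ ((1 + l ^ 2 * b) ^ d)⁻¹ := by gcongr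
            _ = (1 + l ^ 2 * b) ^ (-(d:ℝ)) := by
              rw [Real.rpow_neg h0.le, Real.rpow_natCast]
            _ ≤ _ := by
              apply Real.rpow_le_rpow_of_exponent_le hs
              have : (0:ℝ) ≤ d := Nat.cast_nonneg d
              linarith
        have e3 : (2 * (r + 2) ^ 2)⁻¹ ≤ (1 + l ^ 2)⁻¹ := by
          apply inv_anti₀ (by positivity)
          linarith
        unfold hsW
        gcongr
    _ ≤ _ := by
      apply setIntegral_mono_set (hs_int d hb ha)
      · filter_upwards with l
        have := hsW_pos d hb l
        simp only [Pi.zero_apply]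
        positivity
      · exact hsub.eventuallyLE

lemma hs_poly (d : ℕ) {b : ℝ} (hb : 0 < b) : ∃ K : ℝ, 0 ≤ K ∧ ∀ r : ℝ, 0 ≤ r →
    r * Real.exp (-(r / 2)) ≤ K * (Real.exp (-(1 / (2 * b))) *
      ((((1 + b) * (r + 2) ^ 2) ^ d)⁻¹ * (2 * (r + 2) ^ 2)⁻¹)) := by
  set n := 2 * d + 3 with hn
  refine ⟨Real.exp (1 / (2 * b)) * (1 + b) ^ d * 2 * (2 ^ n * n.factorial * Real.exp 1),
    by positivity, ?_⟩
  intro r hr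
  have h1 : (r + 2) ^ n ≤ 2 ^ n * n.factorial * Real.exp 1 * Real.exp (r / 2) := by
    have h := Real.pow_div_factorial_le_exp ((r + 2) / 2) (by positivity) n
    rw [div_le_iff₀ (by positivity), div_pow, div_le_iff₀ (by positivity)] at h
    calc _ ≤ _ := h
      _ = _ := by
        rw [show (r + 2) / 2 = 1 + r / 2 by ring, Real.exp_add]
        ring
  have h2 : r ≤ r + 2 := by linarith
  have hX : 0 < r + 2 := by linarith
  have h3 : r * Real.exp (-(r / 2)) * (r + 2) ^ (2 * d + 2) ≤
      2 ^ n * n.factorial * Real.exp 1 := by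
    calc _ ≤ (r + 2) * Real.exp (-(r / 2)) * (r + 2) ^ (2 * d + 2) := by gcongr
      _ = (r + 2) ^ n * Real.exp (-(r / 2)) := by rw [hn]; ring
      _ ≤ 2 ^ n * n.factorial * Real.exp 1 * Real.exp (r / 2) * Real.exp (-(r / 2)) := by gcongr
      _ = _ := by rw [mul_assoc, ← Real.exp_add]; simp
  have h4 : Real.exp (1 / (2 * b)) * Real.exp (-(1 / (2 * b))) = 1 := by
    rw [← Real.exp_add]; simp
  have h5 : r * Real.exp (-(r / 2)) ≤ (2 ^ n * n.factorial * Real.exp 1) /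
      (r + 2) ^ (2 * d + 2) := by
    rw [le_div_iff₀ (by positivity)]
    exact h3
  refine h5.trans (le_of_eq ?_)
  have hb1 : (1 + b) ≠ 0 := by positivity
  calc _ = (Real.exp (1 / (2 * b)) * Real.exp (-(1 / (2 * b)))) *
        ((2 ^ n * n.factorial * Real.exp 1) / (r + 2) ^ (2 * d + 2)) := by rw [h4, one_mul]
    _ = _ := by
      rw [mul_pow (1 + b), ← pow_mul, pow_add]
      field_simp
      ring

theorem score_uniformly_bounded (d : ℕ) (hd : 1 ≤ d) (τ : ℝ) (hτ : 0 < τ) :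
    letI p : EuclideanSpace ℝ (Fin d) → ℝ := fun y =>
      ((2:ℝ) ^ ((d:ℝ) - 2) * π ^ ((d:ℝ) + 2)) ^ (-(1:ℝ)/2) *
        Cfun d (‖y‖^2 / 2) (τ ^ 2)
    ∃ bτ : ℝ, ∀ y : EuclideanSpace ℝ (Fin d),
      ‖gradient (fun z => Real.log (p z)) y‖ ≤ bτ := by
  have hb : 0 < τ ^ 2 := by positivity
  obtain ⟨K, hK, hKr⟩ := hs_poly d hb
  set I := ∫ l in Set.Ioi (0:ℝ), (1 + l ^ 2)⁻¹ with hI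
  have hI0 : 0 ≤ I := integral_nonneg fun l => by positivity
  refine ⟨1 + K * I, fun y => ?_⟩
  have hr := norm_nonneg y
  have hup := hs_upper d hb hr
  have hlow := hs_lower d hb hr
  have hC : 0 < Cfun d (‖y‖ ^ 2 / 2) (τ ^ 2) := lt_of_lt_of_le (by positivity) hlow
  have hN : 0 ≤ hsN d (‖y‖ ^ 2 / 2) (τ ^ 2) := by
    apply integral_nonneg
    intro l
    have := hsW_pos d hb l
    simp only [Pi.zero_apply]
    positivity
  set k := ((2:ℝ) ^ ((d:ℝ) - 2) * π ^ ((d:ℝ) + 2)) ^ (-(1:ℝ)/2) with hk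
  have hk0 : 0 < k := by positivity
  have hsq : HasFDerivAt (fun z : EuclideanSpace ℝ (Fin d) => ‖z‖ ^ 2 / 2) (innerSL ℝ y) y := by
    have h := ((hasStrictFDerivAt_norm_sq y).hasFDerivAt).mul_const (1 / 2 : ℝ)
    have e1 : (1 / 2 : ℝ) • (2 : ℕ) • (innerSL ℝ) y = innerSL ℝ y := by
      ext z; simp
    have e2 : (fun z : EuclideanSpace ℝ (Fin d) => ‖z‖ ^ 2 / 2) =
        fun z => ‖z‖ ^ 2 * (1 / 2) := by
      ext z; ring
    rw [e2]
    exact e1 ▸ h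
  have hCd := (hs_hasDeriv d hb (a := ‖y‖ ^ 2 / 2) (by positivity)).const_mul k
  have hlog := hCd.log (by positivity)
  have hcomp := hlog.comp_hasFDerivAt y hsq
  have hg : ‖gradient (fun z => Real.log (k * Cfun d (‖z‖^2 / 2) (τ ^ 2))) y‖ =
      ‖y‖ * hsN d (‖y‖ ^ 2 / 2) (τ ^ 2) / Cfun d (‖y‖ ^ 2 / 2) (τ ^ 2) := by
    unfold gradient
    rw [LinearIsometryEquiv.norm_map]
    have : fderiv ℝ (fun z : EuclideanSpace ℝ (Fin d) =>
        Real.log (k * Cfun d (‖z‖^2 / 2) (τ ^ 2))) y = _ := hcomp.fderiv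
    rw [this, norm_smul, innerSL_apply_norm, mul_neg, neg_div, norm_neg,
      mul_div_mul_left _ _ hk0.ne', Real.norm_of_nonneg (by positivity)]
    ring
  rw [hg, div_le_iff₀ hC]
  calc _ ≤ _ := hup
    _ ≤ Cfun d (‖y‖ ^ 2 / 2) (τ ^ 2) + (K * Cfun d (‖y‖ ^ 2 / 2) (τ ^ 2)) * I := by
      have := (hKr _ hr).trans (mul_le_mul_of_nonneg_left hlow hK)
      gcongr
    _ = _ := by ring
end

section
/- Let d ≥ 3 be an odd integer. Then there exist constants C > 0 and ε₀ > 0 such that for all 0 < ε < ε₀, |∫_0^ε u^{-1/2} exp(u) E_{(d+1)/2}(u) du − (4/(d-1)) √ε| ≤ C ε^{3/2} · (log(1/ε))^{1(d=3)}, where the logarithmic factor is present only when d = 3. -/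
open MeasureTheory Real

/-- The generalized exponential integral `E_ν(x) = ∫_1^∞ exp(-x t) t^{-ν} dt`. -/
noncomputable def genExpInt (ν x : ℝ) : ℝ :=
  ∫ t in Set.Ioi (1:ℝ), Real.exp (-x * t) / t ^ ν

lemma aux_int (ν : ℝ) (hν : 2 ≤ ν) : IntegrableOn (fun t : ℝ => t ^ (-ν)) (Set.Ioi 1) :=
  integrableOn_Ioi_rpow_of_lt (by linarith) one_pos

lemma aux_int2 (ν u : ℝ) (hν : 2 ≤ ν) (hu : 0 < u) :
    IntegrableOn (fun t : ℝ => (1 - exp (-(u * (t - 1)))) * t ^ (-ν)) (Set.Ioi 1) := by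
  refine (aux_int ν hν).mono' ?_ ?_
  · exact Measurable.aestronglyMeasurable (by fun_prop)
  · refine (ae_restrict_mem measurableSet_Ioi).mono fun t ht => ?_
    have ht1 : (1:ℝ) < t := ht
    have h0 : 0 ≤ u * (t - 1) := mul_nonneg hu.le (by linarith)
    have h1 : exp (-(u * (t - 1))) ≤ 1 := exp_le_one_iff.2 (by linarith)
    have h2 := exp_pos (-(u * (t - 1)))
    have h3 : 0 < t ^ (-ν) := rpow_pos_of_pos (by linarith) _
    rw [norm_of_nonneg (mul_nonneg (by linarith) h3.le)]
    nlinarith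

lemma aux_eq (ν u : ℝ) (hν : 2 ≤ ν) (hu : 0 < u) :
    1 / (ν - 1) - exp u * genExpInt ν u
      = ∫ t in Set.Ioi (1:ℝ), (1 - exp (-(u * (t - 1)))) * t ^ (-ν) := by
  have h1 : (∫ t in Set.Ioi (1:ℝ), t ^ (-ν)) = 1 / (ν - 1) := by
    rw [integral_Ioi_rpow_of_lt (by linarith) one_pos, one_rpow]
    rw [div_eq_div_iff (by linarith) (by linarith)]; ring
  have h2 : exp u * genExpInt ν u
      = ∫ t in Set.Ioi (1:ℝ), (t ^ (-ν) - (1 - exp (-(u * (t - 1)))) * t ^ (-ν)) := by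
    unfold genExpInt
    rw [← integral_const_mul]
    refine setIntegral_congr_fun measurableSet_Ioi fun t ht => ?_
    have ht1 : (1:ℝ) < t := ht
    have : exp (-(u * (t - 1))) = exp u * exp (-u * t) := by
      rw [← exp_add]; ring_nf
    simp only [this]
    rw [rpow_neg (by linarith)]
    ring
  rw [h2, integral_sub (aux_int ν hν) (aux_int2 ν u hν hu), h1]
  ring

lemma aux_nonneg (ν u : ℝ) (hu : 0 < u) :
    0 ≤ ∫ t in Set.Ioi (1:ℝ), (1 - exp (-(u * (t - 1)))) * t ^ (-ν) := by
  refine setIntegral_nonneg measurableSet_Ioi fun t ht => ?_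
  have ht1 : (1:ℝ) < t := ht
  have h0 : 0 ≤ u * (t - 1) := mul_nonneg hu.le (by linarith)
  have h1 : exp (-(u * (t - 1))) ≤ 1 := exp_le_one_iff.2 (by linarith)
  exact mul_nonneg (by linarith) (rpow_nonneg (by linarith) _)

lemma aux_bd (u t : ℝ) (hu : 0 < u) : 1 - exp (-(u * (t - 1))) ≤ u * t := by
  have := add_one_le_exp (-(u * (t - 1)))
  nlinarith

lemma aux_A (ν u : ℝ) (hν : 3 ≤ ν) (hu : 0 < u) :
    (∫ t in Set.Ioi (1:ℝ), (1 - exp (-(u * (t - 1)))) * t ^ (-ν)) ≤ u := by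
  have h1 : (∫ t in Set.Ioi (1:ℝ), u * t ^ (-(2:ℝ))) = u := by
    rw [integral_const_mul, integral_Ioi_rpow_of_lt (by norm_num) one_pos, one_rpow]
    norm_num
  refine le_trans ?_ h1.le
  refine setIntegral_mono_on (aux_int2 ν u (by linarith) hu)
    ((aux_int 2 le_rfl).const_mul u) measurableSet_Ioi fun t ht => ?_
  have ht1 : (1:ℝ) < t := ht
  have ht0 : (0:ℝ) < t := by linarith
  calc (1 - exp (-(u * (t - 1)))) * t ^ (-ν) ≤ (u * t) * t ^ (-(3:ℝ)) := by
        apply mul_le_mul (aux_bd u t hu) (rpow_le_rpow_of_exponent_le ht1.le (by linarith))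
          (rpow_nonneg ht0.le _) (by positivity)
    _ = u * t ^ (-(2:ℝ)) := by
        rw [mul_assoc, ← rpow_one_add' ht0.le (by norm_num)]; norm_num

lemma aux_B (u : ℝ) (hu : 0 < u) (hu1 : u < 1) :
    (∫ t in Set.Ioi (1:ℝ), (1 - exp (-(u * (t - 1)))) * t ^ (-(2:ℝ))) ≤ u * log (1 / u) + u := by
  have hi := aux_int2 2 u le_rfl hu
  have h1u : 1 < 1 / u := by rw [lt_div_iff₀ hu]; linarith
  have hs : Set.Ioi (1:ℝ) = Set.Ioc 1 (1 / u) ∪ Set.Ioi (1 / u) :=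
    (Set.Ioc_union_Ioi_eq_Ioi h1u.le).symm
  have hia := hi.mono_set (show Set.Ioc 1 (1 / u) ⊆ Set.Ioi (1:ℝ) from Set.Ioc_subset_Ioi_self)
  have hib := hi.mono_set (show Set.Ioi (1 / u) ⊆ Set.Ioi (1:ℝ) from Set.Ioi_subset_Ioi h1u.le)
  rw [hs, setIntegral_union (Set.Ioc_disjoint_Ioi le_rfl) measurableSet_Ioi hia hib]
  refine add_le_add ?_ ?_
  · have e : (∫ t in Set.Ioc 1 (1 / u), u * t⁻¹) = u * log (1 / u) := by
      rw [integral_const_mul, ← intervalIntegral.integral_of_le h1u.le,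
        integral_inv_of_pos one_pos (by positivity), div_one]
    refine le_trans ?_ e.le
    refine setIntegral_mono_on hia ?_ measurableSet_Ioc fun t ht => ?_
    · refine (IntegrableOn.mono_set ?_ Set.Ioc_subset_Icc_self)
      refine ContinuousOn.integrableOn_Icc ?_
      refine continuousOn_const.mul (continuousOn_id.inv₀ fun t ht => ?_)
      have : (1:ℝ) ≤ t := ht.1
      exact (by linarith : (0:ℝ) < t).ne'
    · have ht1 : (1:ℝ) < t := ht.1
      have ht0 : (0:ℝ) < t := by linarith
      calc _ ≤ (u * t) * t ^ (-(2:ℝ)) :=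
            mul_le_mul_of_nonneg_right (aux_bd u t hu) (rpow_nonneg ht0.le _)
        _ = u * t⁻¹ := by
            rw [mul_assoc, ← rpow_one_add' ht0.le (by norm_num), ← rpow_neg_one]; norm_num
  · have e : (∫ t in Set.Ioi (1 / u), t ^ (-(2:ℝ))) = u := by
      rw [integral_Ioi_rpow_of_lt (by norm_num) (by positivity)]
      norm_num
      rw [rpow_neg_one, inv_inv]
    refine le_trans ?_ e.le
    refine setIntegral_mono_on hib
      (integrableOn_Ioi_rpow_of_lt (by norm_num) (by positivity)) measurableSet_Ioi fun t ht => ?_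
    have ht1 : 1 / u < t := ht
    have h3 : 0 ≤ t ^ (-(2:ℝ)) := rpow_nonneg (by linarith) _
    have := exp_pos (-(u * (t - 1)))
    nlinarith

lemma aux_meas (ν : ℝ) : Measurable (genExpInt ν) := by
  unfold genExpInt
  refine StronglyMeasurable.measurable ?_
  refine StronglyMeasurable.integral_prod_right (f := fun x t : ℝ => exp (-x * t) / t ^ ν) ?_
  exact Measurable.stronglyMeasurable (by unfold Function.uncurry; fun_prop)

lemma aux_main (ν ε M : ℝ) (hν : 2 ≤ ν) (hε : 0 < ε)
    (hM : ∀ u, 0 < u → u ≤ ε →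
      u ^ (-(1:ℝ)/2) * (∫ t in Set.Ioi (1:ℝ), (1 - exp (-(u * (t - 1)))) * t ^ (-ν)) ≤ M) :
    |(∫ u in (0:ℝ)..ε, u ^ (-(1:ℝ)/2) * Real.exp u * genExpInt ν u)
          - (2 / (ν - 1)) * Real.sqrt ε| ≤ M * ε := by
  have hb : ∀ u ∈ Set.uIoc 0 ε, ‖u ^ (-(1:ℝ)/2) * (1 / (ν - 1) - exp u * genExpInt ν u)‖ ≤ M := by
    intro u hu
    rw [Set.uIoc_of_le hε.le] at hu
    rw [aux_eq ν u hν hu.1, norm_of_nonneg]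
    · exact hM u hu.1 hu.2
    · exact mul_nonneg (rpow_nonneg hu.1.le _) (aux_nonneg ν u hu.1)
  have hI1 : IntervalIntegrable (fun u : ℝ => u ^ (-(1:ℝ)/2) * (1 / (ν - 1))) volume 0 ε :=
    (intervalIntegral.intervalIntegrable_rpow' (by norm_num)).mul_const _
  have hI2 : IntervalIntegrable
      (fun u : ℝ => u ^ (-(1:ℝ)/2) * (1 / (ν - 1) - exp u * genExpInt ν u)) volume 0 ε := by
    refine (intervalIntegrable_const (c := M)).mono_fun' ?_ ?_
    · have := aux_meas ν
      exact Measurable.aestronglyMeasurable (by fun_prop)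
    · exact (ae_restrict_mem measurableSet_uIoc).mono fun u hu => hb u hu
  have e1 : (∫ u in (0:ℝ)..ε, u ^ (-(1:ℝ)/2) * (1 / (ν - 1))) = (2 / (ν - 1)) * Real.sqrt ε := by
    rw [intervalIntegral.integral_mul_const, integral_rpow (Or.inl (by norm_num)), sqrt_eq_rpow]
    norm_num
    ring
  have e2 : (∫ u in (0:ℝ)..ε, u ^ (-(1:ℝ)/2) * Real.exp u * genExpInt ν u)
      = (2 / (ν - 1)) * Real.sqrt ε
        - ∫ u in (0:ℝ)..ε, u ^ (-(1:ℝ)/2) * (1 / (ν - 1) - exp u * genExpInt ν u) := by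
    rw [← e1, ← intervalIntegral.integral_sub hI1 hI2]
    refine intervalIntegral.integral_congr fun u _ => ?_
    ring
  have := intervalIntegral.norm_integral_le_of_norm_le_const hb
  rw [sub_zero, abs_of_pos hε, norm_eq_abs] at this
  rw [e2, sub_sub_cancel_left, abs_neg]
  exact this

lemma aux_half (u : ℝ) (hu : 0 < u) : u ^ (-(1:ℝ)/2) * u = sqrt u := by
  rw [← rpow_add_one' hu.le (by norm_num), sqrt_eq_rpow]; norm_num

lemma aux_32 (u : ℝ) (hu : 0 < u) : sqrt u * u = u ^ ((3:ℝ)/2) := by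
  rw [sqrt_eq_rpow, ← rpow_add_one' hu.le (by norm_num)]; norm_num

theorem small_eps_asymptotics_d_odd (d : ℕ) (hd : 3 ≤ d) (hodd : Odd d) :
    ∃ C > (0:ℝ), ∃ ε₀ > (0:ℝ), ∀ ε : ℝ, 0 < ε → ε < ε₀ →
      |(∫ u in (0:ℝ)..ε, u ^ (-(1:ℝ)/2) * Real.exp u * genExpInt (((d:ℝ) + 1) / 2) u)
          - (4 / ((d:ℝ) - 1)) * Real.sqrt ε|
        ≤ C * ε ^ ((3:ℝ)/2) * (Real.log (1 / ε)) ^ (if d = 3 then 1 else 0) := by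
  have hd' : (3:ℝ) ≤ d := by exact_mod_cast hd
  have hc : 4 / ((d:ℝ) - 1) = 2 / (((d:ℝ) + 1) / 2 - 1) := by
    rw [div_eq_div_iff (by linarith) (by linarith)]; ring
  rw [hc]
  by_cases h3 : d = 3
  · subst h3
    refine ⟨2, by norm_num, exp (-2), exp_pos _, fun ε hε hε2 => ?_⟩
    refine (aux_main _ ε (2 * (sqrt ε * log (1 / ε))) (by norm_num) hε ?_).trans ?_
    · intro u hu hue
      have e : (((3:ℕ):ℝ) + 1) / 2 = 2 := by norm_num
      rw [e]
      have hu1 : u < 1 := by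
        have : exp (-2) < 1 := exp_lt_one_iff.2 (by norm_num)
        linarith
      have hlarge : ∀ v : ℝ, 0 < v → v ≤ ε → exp 2 ≤ 1 / v := fun v hv hve => by
        rw [le_div_iff₀ hv]
        have h := mul_le_mul_of_nonneg_left (hve.trans hε2.le) (exp_pos 2).le
        rwa [← exp_add, add_neg_cancel, exp_zero] at h
      have hlog : 2 ≤ log (1 / u) := (le_log_iff_exp_le (by positivity)).2 (hlarge u hu hue)
      have hanti := log_div_sqrt_antitoneOn (hlarge ε hε le_rfl) (hlarge u hu hue)
        (one_div_le_one_div_of_le hu hue)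
      have hB := aux_B u hu hu1
      have hsq : ∀ v : ℝ, log (1 / v) / sqrt (1 / v) = sqrt v * log (1 / v) := fun v => by
        rw [sqrt_div zero_le_one, sqrt_one, div_div_eq_mul_div, div_one, mul_comm]
      simp only [hsq] at hanti
      have hB2 : (∫ t in Set.Ioi (1:ℝ), (1 - exp (-(u * (t - 1)))) * t ^ (-(2:ℝ)))
          ≤ u * (2 * log (1 / u)) := by nlinarith
      calc _ ≤ u ^ (-(1:ℝ)/2) * (u * (2 * log (1 / u))) :=
            mul_le_mul_of_nonneg_left hB2 (rpow_nonneg hu.le _)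
        _ = 2 * (sqrt u * log (1 / u)) := by rw [← mul_assoc, aux_half u hu]; ring
        _ ≤ _ := by linarith
    · rw [if_pos rfl, pow_one, ← aux_32 ε hε]
      exact le_of_eq (by ring)
  · have hd5 : 5 ≤ d := by
      obtain ⟨k, hk⟩ := hodd
      omega
    have hd5' : (5:ℝ) ≤ d := by exact_mod_cast hd5
    refine ⟨1, one_pos, 1, one_pos, fun ε hε _ => ?_⟩
    refine (aux_main _ ε (sqrt ε) (by linarith) hε ?_).trans ?_
    · intro u hu hue
      calc _ ≤ u ^ (-(1:ℝ)/2) * u :=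
            mul_le_mul_of_nonneg_left (aux_A _ u (by linarith) hu) (rpow_nonneg hu.le _)
        _ = sqrt u := aux_half u hu
        _ ≤ _ := sqrt_le_sqrt hue
    · rw [if_neg h3, pow_zero, aux_32 ε hε]
      simp
end

section
/- Let d ≥ 2 be an integer. Then the Grouped Horseshoe prior mass of a shrinking Euclidean ball about the origin satisfies lim_{r → 0⁺} (1/r) ∫_{{θ ∈ ℝ^d : ‖θ‖ ≤ r}} p_{HS,d}(θ) dθ = 2√2 · Γ((d+1)/2) / (π (d-1) Γ(d/2)). -/
open MeasureTheory Real Filter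

/-- The Grouped Horseshoe density on `ℝ^d`. -/
noncomputable def pHS (d : ℕ) (x : EuclideanSpace ℝ (Fin d)) : ℝ :=
  ∫ l in Set.Ioi (0:ℝ),
    (2 * π * l ^ 2) ^ (-(d:ℝ)/2) * Real.exp (-‖x‖^2 / (2 * l ^ 2)) *
      (2 / (π * (1 + l ^ 2)))

/-- The rescaled radial profile. -/
noncomputable def hsF (d : ℕ) (y u : ℝ) : ℝ :=
  (2 * π) ^ (-(d:ℝ)/2) * (u ^ ((d:ℝ) - 2) * Real.exp (-(1/2) * u ^ (2:ℝ))) *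
    (2 / (π * (1 + (y / u) ^ 2)))

noncomputable def hsH (d : ℕ) (y : ℝ) : ℝ := ∫ u in Set.Ioi (0:ℝ), hsF d y u

noncomputable def hsG (d : ℕ) (y : ℝ) : ℝ := ∫ l in Set.Ioi (0:ℝ),
    (2 * π * l ^ 2) ^ (-(d:ℝ)/2) * Real.exp (-y^2 / (2 * l ^ 2)) *
      (2 / (π * (1 + l ^ 2)))

lemma hs_subst (d : ℕ) (hd : 2 ≤ d) (y : ℝ) (hy : 0 < y) :
    y ^ (d - 1) * hsG d y = hsH d y := by
  unfold hsG hsH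
  set h : ℝ → ℝ := fun l => (2 * π * l ^ 2) ^ (-(d:ℝ)/2) * Real.exp (-y^2 / (2 * l ^ 2)) *
      (2 / (π * (1 + l ^ 2))) with hh
  have e1 := integral_comp_mul_left_Ioi h 0 hy
  have e2 := integral_comp_rpow_Ioi (fun s => h (y * s)) (p := -1) (by norm_num)
  rw [mul_zero] at e1
  have e3 : ∫ l in Set.Ioi (0:ℝ), h l = y * ∫ s in Set.Ioi (0:ℝ), h (y * s) := by
    rw [e1, smul_eq_mul]; field_simp
  rw [e3, ← e2, ← mul_assoc, ← integral_const_mul]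
  refine setIntegral_congr_fun measurableSet_Ioi fun u hu => ?_
  have hu : 0 < u := hu
  have hy2 : y ^ (d - 1) * y = y ^ (d:ℝ) := by
    rw [← pow_succ, Nat.sub_add_cancel (by omega), rpow_natCast]
  simp only [hh, hsF, smul_eq_mul]
  rw [hy2, rpow_neg_one]
  have a1 : (2 * π * (y * u⁻¹) ^ 2) ^ (-(d:ℝ)/2) = (2 * π) ^ (-(d:ℝ)/2) * ((y ^ (d:ℝ))⁻¹ * u ^ (d:ℝ)) := by
    rw [mul_rpow (by positivity) (by positivity), ← rpow_natCast, ← rpow_mul (by positivity)]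
    have : ((2:ℕ):ℝ) * (-(d:ℝ)/2) = -(d:ℝ) := by push_cast; ring
    rw [this, mul_rpow hy.le (by positivity), rpow_neg hy.le, inv_rpow hu.le, rpow_neg hu.le, inv_inv]
  have a2 : -y ^ 2 / (2 * (y * u⁻¹) ^ 2) = -(1/2) * u ^ (2:ℝ) := by
    rw [rpow_two]; field_simp
  have a3 : u ^ ((d:ℝ) - 2) = u ^ (d:ℝ) * u ^ ((-1:ℝ) - 1) := by
    rw [← rpow_add hu]; congr 1; ring
  have hyd : y ^ (d:ℝ) ≠ 0 := (rpow_pos_of_pos hy _).ne'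
  rw [a1, a2, a3, div_eq_mul_inv y u]
  have : |(-1:ℝ)| = 1 := by norm_num
  rw [this]
  field_simp

lemma hs_int_s18 (d : ℕ) (hd : 2 ≤ d) : IntegrableOn
    (fun u : ℝ => (2 * π) ^ (-(d:ℝ)/2) * (u ^ ((d:ℝ) - 2) * Real.exp (-(1/2) * u ^ (2:ℝ))) * (2 / π))
    (Set.Ioi 0) := by
  have hd' : (2:ℝ) ≤ d := by exact_mod_cast hd
  have := integrableOn_rpow_mul_exp_neg_mul_rpow (s := (d:ℝ) - 2) (p := 2) (b := 1/2)
    (by linarith) (by norm_num) (by norm_num)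
  exact (this.const_mul _).mul_const _

lemma hs_cont (d : ℕ) (hd : 2 ≤ d) : Continuous (hsH d) := by
  unfold hsH
  refine continuous_of_dominated (bound := fun u : ℝ => (2 * π) ^ (-(d:ℝ)/2) *
    (u ^ ((d:ℝ) - 2) * Real.exp (-(1/2) * u ^ (2:ℝ))) * (2 / π)) ?_ ?_ (hs_int_s18 d hd) ?_
  · intro y
    apply Measurable.aestronglyMeasurable
    unfold hsF
    fun_prop
  · intro y
    filter_upwards [ae_restrict_mem measurableSet_Ioi] with u hu
    have hu : 0 < u := hu
    unfold hsF
    rw [Real.norm_of_nonneg (by positivity)]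
    gcongr
    have := pi_pos
    nlinarith [mul_nonneg this.le (sq_nonneg (y / u))]
  · filter_upwards with u
    unfold hsF
    have : ∀ y : ℝ, π * (1 + (y / u) ^ 2) ≠ 0 := fun y => by positivity
    fun_prop (disch := assumption)

lemma hs_zero (d : ℕ) (hd : 2 ≤ d) : hsH d 0 =
    (2 * π) ^ (-(d:ℝ)/2) * ((1/2:ℝ) ^ (-((d:ℝ) - 1) / 2) * (1/2) * Gamma (((d:ℝ) - 1)/2)) * (2 / π) := by
  have hd' : (2:ℝ) ≤ d := by exact_mod_cast hd
  have := integral_rpow_mul_exp_neg_mul_rpow (p := 2) (q := (d:ℝ) - 2) (b := 1/2)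
    (by norm_num) (by linarith) (by norm_num)
  unfold hsH hsF
  simp only [zero_div, ne_eq, OfNat.ofNat_ne_zero, not_false_eq_true, zero_pow, add_zero, mul_one]
  rw [integral_mul_const, integral_const_mul, this]
  have e : (d:ℝ) - 2 + 1 = d - 1 := by ring
  rw [e]

lemma hs_mass (d : ℕ) (hd : 2 ≤ d) (r : ℝ) (hr : 0 < r) :
    ∫ θ in Metric.closedBall (0 : EuclideanSpace ℝ (Fin d)) r, pHS d θ =
     (d * (√π ^ d / Gamma ((d:ℝ)/2 + 1))) * ∫ y in (0:ℝ)..r, hsH d y := by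
  have : NeZero d := ⟨by omega⟩
  rw [← integral_indicator Metric.isClosed_closedBall.measurableSet]
  have e : (Metric.closedBall (0 : EuclideanSpace ℝ (Fin d)) r).indicator (pHS d) =
      fun θ => (Set.Iic r).indicator (hsG d) ‖θ‖ := by
    funext θ
    simp only [Set.indicator, mem_closedBall_zero_iff, Set.mem_Iic]
    rfl
  rw [e, integral_fun_norm_addHaar, finrank_euclideanSpace_fin, Measure.real,
    EuclideanSpace.volume_ball, intervalIntegral.integral_of_le hr.le]
  have hG : 0 < Gamma ((d:ℝ)/2 + 1) := Gamma_pos_of_pos (by positivity)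
  have e2 : ∫ y in Set.Ioi (0:ℝ), y ^ (d - 1) • (Set.Iic r).indicator (hsG d) y
      = ∫ y in Set.Ioc (0:ℝ) r, hsH d y := by
    rw [← Set.Ioi_inter_Iic, ← setIntegral_indicator measurableSet_Iic]
    refine setIntegral_congr_fun measurableSet_Ioi fun y hy => ?_
    simp only [Set.indicator]
    split_ifs
    · exact hs_subst d hd y hy
    · simp
  rw [e2]
  simp only [Fintype.card_fin, nsmul_eq_mul, smul_eq_mul, ENNReal.ofReal_one, one_pow, one_mul]
  rw [ENNReal.toReal_ofReal (by positivity), mul_assoc]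

lemma hs_const (d : ℕ) (hd : 2 ≤ d) :
    (d * (√π ^ d / Gamma ((d:ℝ)/2 + 1))) * hsH d 0 =
    2 * Real.sqrt 2 * Real.Gamma (((d:ℝ) + 1) / 2) /
        (π * ((d:ℝ) - 1) * Real.Gamma ((d:ℝ) / 2)) := by
  have hd' : (2:ℝ) ≤ d := by exact_mod_cast hd
  have h1 : Gamma ((d:ℝ)/2 + 1) = d/2 * Gamma ((d:ℝ)/2) := Gamma_add_one (by positivity)
  have h2 : Gamma (((d:ℝ) + 1)/2) = ((d:ℝ)-1)/2 * Gamma (((d:ℝ)-1)/2) := by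
    rw [← Gamma_add_one (by linarith)]; congr 1; ring
  have hG : 0 < Gamma ((d:ℝ)/2) := Gamma_pos_of_pos (by positivity)
  have h3 : √π ^ d = π ^ ((d:ℝ)/2) := by
    rw [sqrt_eq_rpow, ← rpow_natCast, ← rpow_mul pi_pos.le]; congr 1; ring
  have h4 : (2 * π) ^ (-(d:ℝ)/2) = (2:ℝ) ^ (-(d:ℝ)/2) * (π ^ ((d:ℝ)/2))⁻¹ := by
    rw [mul_rpow (by norm_num) pi_pos.le, neg_div, rpow_neg pi_pos.le]
  have h5 : (1/2:ℝ) ^ (-((d:ℝ) - 1) / 2) = (2:ℝ) ^ (((d:ℝ) - 1) / 2) := by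
    rw [one_div, inv_rpow (by norm_num), ← rpow_neg (by norm_num)]; congr 1; ring
  have h6 : (2:ℝ) ^ (-(d:ℝ)/2) * (2:ℝ) ^ (((d:ℝ) - 1) / 2) = (√2)⁻¹ := by
    rw [← rpow_add (by norm_num), sqrt_eq_rpow, ← rpow_neg (by norm_num)]; congr 1; ring
  have h7 : (√2)⁻¹ = √2 / 2 := by
    have := sq_sqrt (show (0:ℝ) ≤ 2 by norm_num)
    field_simp; linarith
  have hp : 0 < π ^ ((d:ℝ)/2) := rpow_pos_of_pos pi_pos _
  have hd1 : (d:ℝ) - 1 ≠ 0 := by linarith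
  rw [hs_zero d hd, h1, h2, h3, h4, h5]
  rw [h7] at h6
  calc _ = ((2:ℝ) ^ (-(d:ℝ)/2) * (2:ℝ) ^ (((d:ℝ) - 1) / 2)) * (2 * Gamma (((d:ℝ)-1)/2) / (π * Gamma ((d:ℝ)/2))) := by
        field_simp
    _ = _ := by rw [h6]; field_simp

theorem grouped_horseshoe_ball_mass_asymptotics (d : ℕ) (hd : 2 ≤ d) :
    Tendsto
      (fun r : ℝ =>
        (1 / r) * ∫ θ in Metric.closedBall (0 : EuclideanSpace ℝ (Fin d)) r, pHS d θ)
      (nhdsWithin 0 (Set.Ioi 0))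
      (nhds (2 * Real.sqrt 2 * Real.Gamma (((d:ℝ) + 1) / 2) /
        (π * ((d:ℝ) - 1) * Real.Gamma ((d:ℝ) / 2)))) := by
  rw [← hs_const d hd]
  have hc := hs_cont d hd
  have hD : HasDerivAt (fun r => ∫ y in (0:ℝ)..r, hsH d y) (hsH d 0) 0 :=
    intervalIntegral.integral_hasDerivAt_right (hc.intervalIntegrable _ _)
      hc.aestronglyMeasurable.stronglyMeasurableAtFilter hc.continuousAt
  have hT := (hD.tendsto_slope_zero_right).const_mul (d * (√π ^ d / Gamma ((d:ℝ)/2 + 1)))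
  refine hT.congr' ?_
  filter_upwards [self_mem_nhdsWithin] with r hr
  rw [hs_mass d hd r hr]
  simp
  ring
end
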